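/- arXiv:2005.08495 — 2 statements merged into one kernel-verified Lean document; each statement's English description precedes it below -/
import Mathlib

section
/- Let α > 1, h ≥ 0 integrable on [0,∞) with Λ = ∫₀^∞ h(t)t^(α-1) dt < Γ(α). Define K₁*(t,s) = 0 for s ≤ t and 1 for t ≤ s, and K₂*(t,s) = Γ(α)/(Γ(α)-Λ) · ∫₀^∞ h(τ)K₁(τ,s) dτ with K₁ the half-line Green kernel. Then 0 ≤ K₁*(t,s) + K₂*(t,s) ≤ Γ(α)/(Γ(α)-Λ) for all t, s ≥ 0. -/
open Real MeasureTheory Set Filter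

noncomputable def K1 (α : ℝ) (t s : ℝ) : ℝ :=
  if s ≤ t then (t ^ (α - 1) - (t - s) ^ (α - 1)) / Real.Gamma α
  else t ^ (α - 1) / Real.Gamma α

noncomputable def K1star (t s : ℝ) : ℝ := if s ≤ t then 0 else 1

theorem K1_nonneg {α t s : ℝ} (hα : 1 < α) (ht : 0 ≤ t) (hs : 0 ≤ s) : 0 ≤ K1 α t s := by
  have hΓ : 0 < Real.Gamma α := Real.Gamma_pos_of_pos (by linarith)
  unfold K1
  split_ifs with hst
  · refine div_nonneg (sub_nonneg.2 ?_) hΓ.le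
    exact Real.rpow_le_rpow (by linarith) (by linarith) (by linarith)
  · exact div_nonneg (Real.rpow_nonneg ht _) hΓ.le

theorem K1_le {α : ℝ} (hα : 1 < α) (t s : ℝ) : K1 α t s ≤ t ^ (α - 1) / Real.Gamma α := by
  have hΓ : 0 < Real.Gamma α := Real.Gamma_pos_of_pos (by linarith)
  unfold K1
  split_ifs with hst
  · gcongr
    exact sub_le_self _ (Real.rpow_nonneg (by linarith) _)
  · exact le_rfl

theorem K1star_nonneg (t s : ℝ) : 0 ≤ K1star t s := by
  unfold K1star; split_ifs <;> norm_num

theorem K1star_le_one (t s : ℝ) : K1star t s ≤ 1 := by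
  unfold K1star; split_ifs <;> norm_num

theorem stmt3 (α : ℝ) (hα : 1 < α) (h : ℝ → ℝ) (hh : ∀ t, 0 ≤ h t)
    (hint : IntegrableOn (fun t => h t * t ^ (α - 1)) (Ioi 0))
    (Λ : ℝ) (hΛ : Λ = ∫ t in Ioi (0:ℝ), h t * t ^ (α - 1))
    (hΛlt : Λ < Real.Gamma α)
    (K2star : ℝ → ℝ → ℝ)
    (hK2star : ∀ t s, K2star t s =
      Real.Gamma α / (Real.Gamma α - Λ) * ∫ τ in Ioi (0:ℝ), h τ * K1 α τ s) :
    ∀ t s : ℝ, 0 ≤ t → 0 ≤ s →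
      0 ≤ K1star t s + K2star t s ∧
      K1star t s + K2star t s ≤ Real.Gamma α / (Real.Gamma α - Λ) := by
  intro t s _ hs
  have hΓ : 0 < Real.Gamma α := Real.Gamma_pos_of_pos (by linarith)
  have hd : 0 < Real.Gamma α - Λ := sub_pos.2 hΛlt
  have hnonneg : ∀ τ ∈ Ioi (0 : ℝ), 0 ≤ h τ * K1 α τ s := fun τ hτ =>
    mul_nonneg (hh τ) (K1_nonneg hα (le_of_lt hτ) hs)
  have hI0 : 0 ≤ ∫ τ in Ioi (0 : ℝ), h τ * K1 α τ s :=
    setIntegral_nonneg measurableSet_Ioi hnonneg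
  have hI1 : ∫ τ in Ioi (0 : ℝ), h τ * K1 α τ s ≤ Λ / Real.Gamma α := by
    rw [hΛ, ← integral_div]
    refine integral_mono_of_nonneg (ae_restrict_of_forall_mem measurableSet_Ioi hnonneg)
      (hint.div_const _) (Eventually.of_forall fun τ => ?_)
    simpa only [mul_div_assoc] using mul_le_mul_of_nonneg_left (K1_le hα τ s) (hh τ)
  rw [hK2star]
  constructor
  · exact add_nonneg (K1star_nonneg t s) (mul_nonneg (div_nonneg hΓ.le hd.le) hI0)
  · calc _ ≤ 1 + Real.Gamma α / (Real.Gamma α - Λ) * (Λ / Real.Gamma α) :=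
          add_le_add (K1star_le_one t s)
            (mul_le_mul_of_nonneg_left hI1 (div_nonneg hΓ.le hd.le))
      _ = Real.Gamma α / (Real.Gamma α - Λ) := by
          field_simp
          ring
end

section
/- Let y : [0,∞) → ℝ be continuous and integrable, α ∈ (n-1, n] with n ≥ 2, h ≥ 0 integrable with Λ = ∫₀^∞ h(t)t^(α-1) dt < Γ(α), and suppose ∫₀^∞ h(t) ∫₀^∞ K₁(t,s) y(s) ds dt is finite. If u(t) = ∫₀^∞ K(t,s) y(s) ds where K = K₁ + K₂ is the Green kernel defined by K₁(t,s) = (t^(α-1)-(t-s)^(α-1))/Γ(α) for s ≤ t, t^(α-1)/Γ(α) for t ≤ s, and K₂(t,s) = t^(α-1)/(Γ(α)-Λ)·∫₀^∞ h(τ)K₁(τ,s) dτ, then u(t) = −(1/Γ(α))∫₀^t (t−s)^(α-1) y(s) ds + c t^(α-1), where c = (1/(Γ(α)−Λ)) ∫₀^∞ h(τ) ∫₀^∞ K₁(τ,s) y(s) ds dτ + (1/Γ(α)) ∫₀^∞ y(s) ds. -/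
open Real MeasureTheory Set Filter

lemma measurable_K1_uncurry (α : ℝ) : Measurable fun p : ℝ × ℝ => K1 α p.1 p.2 := by
  unfold K1
  refine Measurable.ite (measurableSet_le measurable_snd measurable_fst) ?_ ?_ <;> fun_prop

lemma norm_K1_le {α t s : ℝ} (hα : 1 < α) (ht : 0 ≤ t) (hs : 0 ≤ s) :
    ‖K1 α t s‖ ≤ t ^ (α - 1) / Real.Gamma α := by
  have hΓ : 0 < Real.Gamma α := Real.Gamma_pos_of_pos (by linarith)
  have ht' : 0 ≤ t ^ (α - 1) := Real.rpow_nonneg ht _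
  unfold K1
  split_ifs with hst
  · have h1 : 0 ≤ (t - s) ^ (α - 1) := Real.rpow_nonneg (by linarith) _
    have h2 : (t - s) ^ (α - 1) ≤ t ^ (α - 1) :=
      Real.rpow_le_rpow (by linarith) (by linarith) (by linarith)
    rw [Real.norm_of_nonneg (div_nonneg (by linarith) hΓ.le)]
    gcongr
    linarith
  · rw [Real.norm_of_nonneg (by positivity)]

lemma integrableOn_K1_mul {α t : ℝ} {y : ℝ → ℝ} (hα : 1 < α) (ht : 0 ≤ t)
    (hy : IntegrableOn y (Ioi 0)) : IntegrableOn (fun s => K1 α t s * y s) (Ioi 0) := by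
  refine Integrable.bdd_mul hy
    ((measurable_K1_uncurry α).comp measurable_prodMk_left).aestronglyMeasurable
    (c := t ^ (α - 1) / Real.Gamma α) ?_
  filter_upwards [ae_restrict_mem measurableSet_Ioi] with s hs
  exact norm_K1_le hα ht (le_of_lt hs)

lemma integrable_mul_K1_mul {α : ℝ} {y h : ℝ → ℝ} (hα : 1 < α)
    (hy : IntegrableOn y (Ioi 0)) (hh : IntegrableOn (fun t => h t * t ^ (α - 1)) (Ioi 0)) :
    Integrable (fun p : ℝ × ℝ => h p.1 * K1 α p.1 p.2 * y p.2)
      ((volume.restrict (Ioi 0)).prod (volume.restrict (Ioi 0))) := by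
  have hpos : ∀ᵐ p : ℝ × ℝ ∂((volume.restrict (Ioi (0 : ℝ))).prod (volume.restrict (Ioi (0 : ℝ)))),
      p ∈ Ioi (0 : ℝ) ×ˢ Ioi (0 : ℝ) := by
    rw [Measure.prod_restrict]
    exact ae_restrict_mem (measurableSet_Ioi.prod measurableSet_Ioi)
  have hm : Measurable fun p : ℝ × ℝ => K1 α p.1 p.2 / p.1 ^ (α - 1) :=
    (measurable_K1_uncurry α).div (by fun_prop)
  refine ((hh.mul_prod hy).bdd_mul hm.aestronglyMeasurable
    (c := 1 / Real.Gamma α) ?_).congr ?_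
  · filter_upwards [hpos] with p hp
    have hp1 : 0 < p.1 ^ (α - 1) := Real.rpow_pos_of_pos hp.1 _
    rw [norm_div, Real.norm_of_nonneg hp1.le, div_le_iff₀ hp1]
    calc ‖K1 α p.1 p.2‖ ≤ _ := norm_K1_le hα (le_of_lt hp.1) (le_of_lt hp.2)
      _ = _ := by ring
  · filter_upwards [hpos] with p hp
    have hp1 : p.1 ^ (α - 1) ≠ 0 := (Real.rpow_pos_of_pos hp.1 _).ne'
    field_simp

lemma integral_K1_mul {α t : ℝ} {y : ℝ → ℝ} (hα : 1 < α) (ht : 0 ≤ t) (hy : Continuous y)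
    (hyint : IntegrableOn y (Ioi 0)) :
    ∫ s in Ioi (0 : ℝ), K1 α t s * y s =
      t ^ (α - 1) / Real.Gamma α * (∫ s in Ioi (0 : ℝ), y s) -
        1 / Real.Gamma α * ∫ s in (0 : ℝ)..t, (t - s) ^ (α - 1) * y s := by
  have hcont : Continuous fun s => (t - s) ^ (α - 1) * y s :=
    ((continuous_const.sub continuous_id).rpow_const fun _ => Or.inr (by linarith)).mul hy
  have hset : Ioi (0 : ℝ) ∩ Iic t = Ioc 0 t := Ioi_inter_Iic
  have hind : IntegrableOn ((Iic t).indicator fun s => (t - s) ^ (α - 1) * y s) (Ioi 0) := by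
    rw [IntegrableOn, integrable_indicator_iff measurableSet_Iic, IntegrableOn,
      Measure.restrict_restrict measurableSet_Iic, inter_comm, hset]
    exact hcont.integrableOn_Ioc
  have heq : ∀ s, K1 α t s * y s = t ^ (α - 1) / Real.Gamma α * y s -
      1 / Real.Gamma α * (Iic t).indicator (fun s => (t - s) ^ (α - 1) * y s) s := by
    intro s
    by_cases hst : s ≤ t
    · simp only [K1, hst, if_true, indicator, mem_Iic]
      ring
    · simp [K1, hst, indicator]
  simp_rw [heq]
  rw [integral_sub (hyint.const_mul _) (hind.const_mul _), integral_const_mul,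
    integral_const_mul, setIntegral_indicator measurableSet_Iic, hset,
    intervalIntegral.integral_of_le ht]

theorem stmt6 (α : ℝ) (n : ℕ) (hn : 2 ≤ n) (hα1 : (n : ℝ) - 1 < α) (hα2 : α ≤ n)
    (y : ℝ → ℝ) (hy : Continuous y) (hyint : IntegrableOn y (Ioi 0))
    (h : ℝ → ℝ) (hh : ∀ t, 0 ≤ h t)
    (hhint : IntegrableOn (fun t => h t * t ^ (α - 1)) (Ioi 0))
    (Λ : ℝ) (hΛ : Λ = ∫ t in Ioi (0:ℝ), h t * t ^ (α - 1))
    (hΛlt : Λ < Real.Gamma α)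
    (hfin : IntegrableOn
      (fun t => h t * ∫ s in Ioi (0:ℝ), K1 α t s * y s) (Ioi 0))
    (K2 K : ℝ → ℝ → ℝ)
    (hK2 : ∀ t s, K2 t s =
      t ^ (α - 1) / (Real.Gamma α - Λ) * ∫ τ in Ioi (0:ℝ), h τ * K1 α τ s)
    (hK : ∀ t s, K t s = K1 α t s + K2 t s)
    (u : ℝ → ℝ) (hu : ∀ t, u t = ∫ s in Ioi (0:ℝ), K t s * y s)
    (c : ℝ)
    (hc : c = (1 / (Real.Gamma α - Λ)) *
        (∫ τ in Ioi (0:ℝ), h τ * ∫ s in Ioi (0:ℝ), K1 α τ s * y s) +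
      (1 / Real.Gamma α) * ∫ s in Ioi (0:ℝ), y s) :
    ∀ t : ℝ, 0 ≤ t →
      u t = -(1 / Real.Gamma α) * (∫ s in (0:ℝ)..t, (t - s) ^ (α - 1) * y s) +
        c * t ^ (α - 1) := by
  intro t ht
  have hα : 1 < α := by
    have : (2 : ℝ) ≤ n := by exact_mod_cast hn
    linarith
  have hF := integrable_mul_K1_mul hα hyint hhint
  have hinner : ∀ s, ∫ τ in Ioi (0 : ℝ), h τ * K1 α τ s * y s =
      (∫ τ in Ioi (0 : ℝ), h τ * K1 α τ s) * y s := fun s => integral_mul_const _ _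
  have hint : IntegrableOn (fun s => (∫ τ in Ioi (0 : ℝ), h τ * K1 α τ s) * y s) (Ioi 0) := by
    simpa only [hinner, IntegrableOn] using hF.integral_prod_right
  have hswap : ∫ s in Ioi (0 : ℝ), (∫ τ in Ioi (0 : ℝ), h τ * K1 α τ s) * y s =
      ∫ τ in Ioi (0 : ℝ), h τ * ∫ s in Ioi (0 : ℝ), K1 α τ s * y s := by
    simp_rw [← hinner, ← integral_const_mul, ← mul_assoc]
    exact (integral_integral_swap hF).symm
  have hsplit : ∀ s, K t s * y s = K1 α t s * y s +
      t ^ (α - 1) / (Real.Gamma α - Λ) *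
        ((∫ τ in Ioi (0 : ℝ), h τ * K1 α τ s) * y s) := by
    intro s
    rw [hK, hK2]
    ring
  rw [hu]
  simp_rw [hsplit]
  rw [integral_add (integrableOn_K1_mul hα ht hyint) (hint.const_mul _), integral_const_mul,
    hswap, integral_K1_mul hα ht hy hyint, hc]
  ring
end
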